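/- Let n, q, z₁, z₂, t be natural numbers with z₂ ≤ z₁ ≤ q ≤ 2t and n ≥ 2t, and set n̄ := n−2t+q. Then there exist rational numbers f(u,v,w), indexed by 0 ≤ u ≤ z₂, 0 ≤ v ≤ q−z₁, 0 ≤ w ≤ z₂−u and not depending on j, such that for every integer j: C(n̄, j+z₁) · C(n̄, j+z₂) = C(n̄+q, j+q) · Σ_{u=0}^{z₂} Σ_{v=0}^{q−z₁} Σ_{w=0}^{z₂−u} f(u,v,w) · C(n−2t, j−v−w+z₂). (In particular, whenever C(n̄+q, j+q) ≠ 0 this gives the identity C(n̄,j+z₁)·C(n̄,j+z₂)/C(n̄+q,j+q) = Σ_{u,v,w} f(u,v,w)·C(n−2t, j−v−w+z₂); when C(n̄+q,j+q) = 0 both sides of the product identity vanish.) -/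

import Mathlib

/-- Binomial coefficient for integer arguments, with the convention
`ibinom x k = 0` whenever `k < 0` or `k > x`. -/
def ibinom (x k : ℤ) : ℤ :=
  if 0 ≤ k ∧ k ≤ x then Nat.choose x.toNat k.toNat else 0

theorem ibinom_natCast (n k : ℕ) : ibinom n k = n.choose k := by
  unfold ibinom
  split_ifs with h
  · simp
  · rw [Nat.choose_eq_zero_of_lt (by omega)]; rfl

theorem ibinom_of_neg (x : ℤ) {k : ℤ} (hk : k < 0) : ibinom x k = 0 :=
  if_neg (by omega)

theorem ibinom_of_lt {x k : ℤ} (hk : x < k) : ibinom x k = 0 :=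
  if_neg (by omega)

theorem ibinom_succ (n : ℕ) (k : ℤ) :
    ibinom ((n : ℤ) + 1) k = ibinom n k + ibinom n (k - 1) := by
  rcases lt_or_ge k 0 with hk | hk
  · rw [ibinom_of_neg _ hk, ibinom_of_neg _ hk, ibinom_of_neg _ (by omega), add_zero]
  · lift k to ℕ using hk
    rcases k with _ | k
    · have h := ibinom_natCast (n + 1) 0
      have h' := ibinom_natCast n 0
      rw [ibinom_of_neg (n : ℤ) (k := ((0 : ℕ) : ℤ) - 1) (by simp)]
      push_cast at h h' ⊢
      simp [h, h']
    · have h := ibinom_natCast (n + 1) (k + 1)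
      have h' := ibinom_natCast n (k + 1)
      rw [show ((k + 1 : ℕ) : ℤ) - 1 = k by push_cast; ring, ibinom_natCast n k, h']
      rw [Nat.choose_succ_succ] at h
      push_cast at h ⊢
      rw [h, add_comm]

theorem mul_ibinom_succ (n : ℕ) (k : ℤ) :
    k * ibinom ((n : ℤ) + 1) k = (n + 1) * ibinom n (k - 1) := by
  rcases lt_or_ge k 0 with hk | hk
  · rw [ibinom_of_neg _ hk, ibinom_of_neg _ (by omega), mul_zero, mul_zero]
  · lift k to ℕ using hk
    rcases k with _ | k
    · rw [ibinom_of_neg (n : ℤ) (k := ((0 : ℕ) : ℤ) - 1) (by simp)]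
      simp
    · have h := ibinom_natCast (n + 1) (k + 1)
      rw [show ((k + 1 : ℕ) : ℤ) - 1 = k by push_cast; ring, ibinom_natCast n k]
      rw [Nat.cast_succ n] at h
      rw [h]
      have := Nat.add_one_mul_choose_eq n k
      zify at this
      push_cast
      linarith

/-- A polynomial of degree at most `d` times a row of Pascal's triangle is a linear combination
of `d + 1` consecutive shifts of the row lying `d` steps above it. -/
theorem exists_eval_mul_ibinom_eq_sum (n d : ℕ) (p : Polynomial ℚ) (hp : p.natDegree ≤ d) :
    ∃ g : ℕ → ℚ, ∀ k : ℤ, p.eval (k : ℚ) * (ibinom ((n : ℤ) + d) k : ℚ) =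
      ∑ s ∈ Finset.range (d + 1), g s * (ibinom n (k - s) : ℚ) := by
  induction d generalizing p with
  | zero =>
    refine ⟨fun _ => p.coeff 0, fun k => ?_⟩
    rw [Polynomial.eq_C_of_natDegree_le_zero hp]
    simp
  | succ d ih =>
    obtain ⟨g₁, hg₁⟩ := ih (Polynomial.C (p.coeff 0)) (by simp)
    have hr : p.divX.natDegree ≤ d := by rw [Polynomial.natDegree_divX_eq_natDegree_tsub_one]; omega
    obtain ⟨g₂, hg₂⟩ := ih (Polynomial.C ((n : ℚ) + d + 1) * Polynomial.taylor 1 p.divX +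
      Polynomial.C (p.coeff 0))
      (Polynomial.natDegree_add_le_of_degree_le
        ((Polynomial.natDegree_C_mul_le _ _).trans (by rwa [Polynomial.natDegree_taylor])) (by simp))
    refine ⟨fun s => (if s ≤ d then g₁ s else 0) + (if s = 0 then 0 else g₂ (s - 1)), fun k => ?_⟩
    have e₁ := hg₁ k
    have e₂ := hg₂ (k - 1)
    have hpk : p.eval (k : ℚ) = p.divX.eval (k : ℚ) * k + p.coeff 0 := by
      conv_lhs => rw [← Polynomial.divX_mul_X_add p]
      simp
    have hs := ibinom_succ (n + d) k
    have hm := mul_ibinom_succ (n + d) k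
    rw [← @Int.cast_inj ℚ] at hs hm
    simp only [add_mul, Finset.sum_add_distrib]
    rw [Finset.sum_range_succ, Finset.sum_range_succ' _ (d + 1)]
    have h₁ : ∑ s ∈ Finset.range (d + 1), (if s ≤ d then g₁ s else 0) * (ibinom n (k - s) : ℚ) =
        ∑ s ∈ Finset.range (d + 1), g₁ s * (ibinom n (k - s) : ℚ) :=
      Finset.sum_congr rfl fun s hs => by rw [if_pos (by simpa [Nat.lt_succ_iff] using hs)]
    have h₂ : ∀ s : ℕ, k - ((s + 1 : ℕ) : ℤ) = k - 1 - s := fun s => by push_cast; ring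
    rw [h₁, ← e₁]
    simp only [h₂, Nat.add_one_ne_zero, if_false, Nat.add_sub_cancel]
    rw [← e₂, hpk]
    simp [Polynomial.taylor_eval] at hs hm ⊢
    rw [← add_assoc]
    linear_combination p.divX.eval (k : ℚ) * hm + p.coeff 0 * hs

/-- The product of two entries of row `N + q` divided by an entry of row `N + 2q`, as a
polynomial multiple of an entry of a single row. -/
theorem exists_ibinom_mul_ibinom_eq (N q z₁ z₂ : ℕ) (h21 : z₂ ≤ z₁) (h1q : z₁ ≤ q) :
    ∃ p : Polynomial ℚ, p.natDegree ≤ q - z₁ + z₂ ∧ ∀ j : ℤ,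
      (ibinom ((N : ℤ) + q) (j + z₁) * ibinom ((N : ℤ) + q) (j + z₂) : ℚ) =
        ibinom ((N : ℤ) + q + q) (j + q) *
          (p.eval ((j + z₂ : ℤ) : ℚ) * ibinom ((N : ℤ) + (q - z₁ + z₂ : ℕ)) (j + z₂)) := by
  obtain ⟨a, rfl⟩ := Nat.exists_eq_add_of_le h1q
  obtain ⟨b, rfl⟩ := Nat.exists_eq_add_of_le h21
  have ha : z₂ + b + a - (z₂ + b) = a := by omega
  rw [ha]
  refine ⟨Polynomial.C (((N + z₂ + b + a).factorial ^ 2 : ℚ) /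
      ((N + 2 * (z₂ + b + a)).factorial * (N + a + z₂).factorial)) *
    ((ascPochhammer ℚ a).comp (Polynomial.X + Polynomial.C (b + 1 : ℚ)) *
      (ascPochhammer ℚ z₂).comp (Polynomial.C (N + z₂ + a + b + 1 : ℚ) - Polynomial.X)), ?_, ?_⟩
  · refine (Polynomial.natDegree_C_mul_le _ _).trans (Polynomial.natDegree_mul_le.trans ?_)
    refine add_le_add (Polynomial.natDegree_comp_le.trans ?_)
      (Polynomial.natDegree_comp_le.trans ?_)
    · rw [ascPochhammer_natDegree, Polynomial.natDegree_X_add_C, mul_one]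
    · rw [ascPochhammer_natDegree]
      refine (Nat.mul_le_mul_left _ (Polynomial.natDegree_sub_le _ _)).trans ?_
      rw [Polynomial.natDegree_C, Polynomial.natDegree_X]
      simp
  · intro j
    rcases lt_or_ge (j + z₂) 0 with hk | hk
    · simp [ibinom_of_neg _ hk]
    rcases lt_or_ge ((N : ℤ) + (a + z₂ : ℕ)) (j + z₂) with hl | hl
    · rw [ibinom_of_lt hl, ibinom_of_lt (k := j + ((z₂ + b : ℕ) : ℤ)) (by push_cast at hl ⊢; omega)]
      simp
    obtain ⟨k, hk⟩ := Int.eq_ofNat_of_zero_le hk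
    obtain ⟨l, hl⟩ := Int.eq_ofNat_of_zero_le (sub_nonneg.2 hl)
    have hkl : k + l = N + a + z₂ := by push_cast at hl; omega
    have c₁ : ibinom ((N : ℤ) + (z₂ + b + a : ℕ)) (j + (z₂ + b : ℕ)) =
        ((k + b + l).choose (k + b) : ℕ) := by
      rw [← ibinom_natCast]; congr 1 <;> push_cast <;> omega
    have c₂ : ibinom ((N : ℤ) + (z₂ + b + a : ℕ)) (j + z₂) = ((k + (b + l)).choose k : ℕ) := by
      rw [← ibinom_natCast]; congr 1; push_cast; omega
    have c₃ : ibinom ((N : ℤ) + (z₂ + b + a : ℕ) + (z₂ + b + a : ℕ)) (j + (z₂ + b + a : ℕ)) =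
        ((k + b + a + (b + l + z₂)).choose (k + b + a) : ℕ) := by
      rw [← ibinom_natCast]; congr 1 <;> push_cast <;> omega
    have c₄ : ibinom ((N : ℤ) + (a + z₂ : ℕ)) (j + z₂) = ((k + l).choose k : ℕ) := by
      rw [← ibinom_natCast]; congr 1; push_cast; omega
    rw [c₁, c₂, c₃, c₄, hk]
    have hNkl : (N + z₂ + a + b + 1 : ℚ) - k = ((b + l + 1 : ℕ) : ℚ) := by
      have : (k + l : ℚ) = N + a + z₂ := by exact_mod_cast hkl
      push_cast; linarith
    have hkb : (k : ℚ) + (b + 1) = ((k + b + 1 : ℕ) : ℚ) := by push_cast; ring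
    simp only [Polynomial.eval_mul, Polynomial.eval_C, Polynomial.eval_comp, Polynomial.eval_add,
      Polynomial.eval_sub, Polynomial.eval_X, Int.cast_natCast]
    rw [hNkl, hkb, ← ascPochhammer_eval_cast, ← ascPochhammer_eval_cast,
      ascPochhammer_nat_eq_ascFactorial, ascPochhammer_nat_eq_ascFactorial]
    have f₁ := Nat.factorial_mul_ascFactorial (k + b) a
    have f₂ := Nat.factorial_mul_ascFactorial (b + l) z₂
    rw [← @Nat.cast_inj ℚ, Nat.cast_mul, mul_comm, ← eq_div_iff (by positivity)] at f₁ f₂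
    rw [f₁, f₂, Nat.cast_add_choose, Nat.cast_add_choose, Nat.cast_add_choose,
      Nat.cast_add_choose, show k + b + a + (b + l + z₂) = N + 2 * (z₂ + b + a) by omega,
      show k + b + l = N + z₂ + b + a by omega, show k + (b + l) = N + z₂ + b + a by omega, hkl]
    field_simp

theorem exists_sum_sum_sum_eq_sum (a b : ℕ) (g : ℕ → ℚ) :
    ∃ f : ℕ → ℕ → ℕ → ℚ, ∀ F : ℕ → ℚ,
      ∑ u ∈ Finset.range (b + 1), ∑ v ∈ Finset.range (a + 1), ∑ w ∈ Finset.range (b - u + 1),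
        f u v w * F (v + w) = ∑ s ∈ Finset.range (a + b + 1), g s * F s := by
  refine ⟨fun u v w => if u = 0 ∧ (v = 0 ∨ w = b) then g (v + w) else 0, fun F => ?_⟩
  rw [Finset.sum_range_succ', Finset.sum_range_succ',
    show a + b + 1 = b + 1 + a by ring,
    Finset.sum_range_add _ (b + 1)]
  have h : ∀ v, v + 1 + b = b + 1 + v := fun v => by ring
  simp [ite_mul, add_comm (∑ _ ∈ Finset.range a, _), h,
    Finset.sum_range_succ _ b]

/-- Let `n, q, z₁, z₂, t` be naturals with `z₂ ≤ z₁ ≤ q ≤ 2t` and `n ≥ 2t`,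
and set `n̄ := n − 2t + q`. There exist rationals `f u v w` (independent of `j`) such that
for every integer `j`:
`C(n̄, j+z₁) · C(n̄, j+z₂)
  = C(n̄+q, j+q) · Σ_{u=0}^{z₂} Σ_{v=0}^{q−z₁} Σ_{w=0}^{z₂−u} f u v w · C(n−2t, j−v−w+z₂)`. -/
theorem stmt_3 (n q z₁ z₂ t : ℕ) (h21 : z₂ ≤ z₁) (h1q : z₁ ≤ q) (hqt : q ≤ 2 * t)
    (htn : 2 * t ≤ n) :
    ∃ f : ℕ → ℕ → ℕ → ℚ,
      ∀ j : ℤ,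
        (ibinom ((n : ℤ) - 2 * t + q) (j + z₁) * ibinom ((n : ℤ) - 2 * t + q) (j + z₂) : ℚ) =
          (ibinom ((n : ℤ) - 2 * t + q + q) (j + q) : ℚ) *
            ∑ u ∈ Finset.range (z₂ + 1), ∑ v ∈ Finset.range (q - z₁ + 1),
              ∑ w ∈ Finset.range (z₂ - u + 1),
                f u v w * (ibinom ((n : ℤ) - 2 * t) (j - v - w + z₂) : ℚ) := by
  obtain ⟨N, rfl⟩ := Nat.exists_eq_add_of_le htn
  have hN : ((2 * t + N : ℕ) : ℤ) - 2 * t = N := by push_cast; ring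
  rw [hN]
  obtain ⟨p, hp, hpj⟩ := exists_ibinom_mul_ibinom_eq N q z₁ z₂ h21 h1q
  obtain ⟨g, hg⟩ := exists_eval_mul_ibinom_eq_sum N (q - z₁ + z₂) p hp
  obtain ⟨f, hf⟩ := exists_sum_sum_sum_eq_sum (q - z₁) z₂ g
  refine ⟨f, fun j => ?_⟩
  rw [hpj, hg, ← hf fun s => (ibinom N (j + z₂ - s) : ℚ)]
  have h : ∀ v w : ℕ, j + z₂ - ((v + w : ℕ) : ℤ) = j - v - w + z₂ := fun v w => by
    push_cast; ring
  simp only [h]
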